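/- arXiv:2007.03997 — 2 statements merged into one kernel-verified Lean document; each statement's English description precedes it below -/
import Mathlib

section
/- Let n ≥ 1 and let Q ∈ ℝ^{(n+1)×(n+1)} be a symmetric positive definite matrix with nonpositive off-diagonal entries (Q_ij ≤ 0 for i ≠ j) that is irreducible, and let S = diag(s_1,…,s_{n+1}) be a diagonal matrix with strictly positive diagonal entries. Let Q_n denote the n×n leading principal submatrix of Q obtained by deleting the last row and column, and S_B = diag(s_1,…,s_n). Then the smallest eigenvalue of the symmetric matrix S^{-1/2} Q S^{-1/2} is strictly less than the smallest eigenvalue of the symmetric matrix S_B^{-1/2} Q_n S_B^{-1/2}. (Equivalently, since S^{-1}Q and S_B^{-1}Q_n are similar to these symmetric matrices, the smallest eigenvalue λ_1 of S^{-1}Q satisfies λ_1 < λ'_1, where λ'_1 is the smallest eigenvalue of S_B^{-1}Q_n.) -/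
open Matrix

/-- The smallest eigenvalue of a (symmetric) real matrix: the infimum of its real spectrum. -/
noncomputable def lambdaMin {n : Type*} [Fintype n] [DecidableEq n] (M : Matrix n n ℝ) : ℝ :=
  sInf (spectrum ℝ M)

/-- A square matrix is irreducible if for every nonempty proper subset `A` of the index set
there are `i ∈ A` and `j ∉ A` with `M i j ≠ 0`. -/
def MatIrreducible {n : Type*} (M : Matrix n n ℝ) : Prop :=
  ∀ A : Set n, A.Nonempty → A ≠ Set.univ → ∃ i ∈ A, ∃ j ∉ A, M i j ≠ 0

section

variable {n : Type*} [Fintype n] {M : Matrix n n ℝ}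

lemma abs_dotProduct_mulVec_abs_le (hoff : ∀ i j, i ≠ j → M i j ≤ 0) (v : n → ℝ) :
    (fun i => |v i|) ⬝ᵥ (M *ᵥ fun i => |v i|) ≤ v ⬝ᵥ (M *ᵥ v) := by
  simp only [dotProduct, mulVec, Finset.mul_sum]
  refine Finset.sum_le_sum fun i _ => Finset.sum_le_sum fun j _ => ?_
  rcases eq_or_ne i j with rfl | hij
  · exact le_of_eq (by linear_combination M i i * abs_mul_abs_self (v i))
  · have h : v i * v j ≤ |v i| * |v j| := abs_mul (v i) (v j) ▸ le_abs_self _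
    nlinarith [hoff i j hij]

/-- A nonnegative eigenvector of an irreducible symmetric matrix with nonpositive off-diagonal
entries which vanishes somewhere is zero. -/
lemma MatIrreducible.eq_zero_of_mulVec_eq_smul (hirr : MatIrreducible M) (hM : M.IsSymm)
    (hoff : ∀ i j, i ≠ j → M i j ≤ 0) {x : n → ℝ} (hx : 0 ≤ x) {r : ℝ} (hr : M *ᵥ x = r • x)
    {k : n} (hk : x k = 0) : x = 0 := by
  by_contra hx0
  obtain ⟨l, hl⟩ := Function.ne_iff.1 hx0
  obtain ⟨i, hi, j, hj, hij⟩ := hirr {i | x i ≠ 0} ⟨l, hl⟩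
    fun h => (h ▸ Set.mem_univ k : k ∈ {i | x i ≠ 0}) hk
  have hj0 : x j = 0 := by simpa using hj
  have hsum : ∑ k, M j k * x k = 0 := by
    simpa [mulVec, dotProduct, hj0] using congrFun hr j
  have hle : ∀ k ∈ Finset.univ, M j k * x k ≤ 0 := fun k _ => by
    rcases eq_or_ne j k with rfl | hjk
    · simp [hj0]
    · exact mul_nonpos_of_nonpos_of_nonneg (hoff j k hjk) (hx k)
  have h := (Finset.sum_eq_zero_iff_of_nonpos hle).1 hsum i (Finset.mem_univ i)
  rw [hM.apply] at h
  exact (mul_ne_zero hij hi) h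

variable [DecidableEq n]

lemma posSemidef_sub_lambdaMin (hM : M.IsHermitian) :
    (M - algebraMap ℝ (Matrix n n ℝ) (lambdaMin M)).PosSemidef := by
  rw [Matrix.posSemidef_iff_isHermitian_and_spectrum_nonneg]
  refine ⟨hM.sub ?_, ?_⟩
  · rw [Matrix.algebraMap_eq_diagonal]
    exact Matrix.isHermitian_diagonal _
  · rw [← spectrum.sub_singleton_eq]
    rintro _ ⟨a, ha, _, rfl, rfl⟩
    exact sub_nonneg.2 (csInf_le M.finite_real_spectrum.bddBelow ha)

lemma sub_algebraMap_mulVec (M : Matrix n n ℝ) (r : ℝ) (x : n → ℝ) :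
    (M - algebraMap ℝ (Matrix n n ℝ) r) *ᵥ x = M *ᵥ x - r • x := by
  rw [Matrix.sub_mulVec, Algebra.algebraMap_eq_smul_one, Matrix.smul_mulVec, Matrix.one_mulVec]

lemma lambdaMin_mul_le (hM : M.IsHermitian) (x : n → ℝ) :
    lambdaMin M * (x ⬝ᵥ x) ≤ x ⬝ᵥ (M *ᵥ x) := by
  have h := (posSemidef_sub_lambdaMin hM).dotProduct_mulVec_nonneg x
  rw [sub_algebraMap_mulVec, star_trivial, dotProduct_sub, dotProduct_smul, smul_eq_mul] at h
  linarith

lemma mulVec_eq_lambdaMin_smul (hM : M.IsHermitian) {x : n → ℝ}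
    (hx : x ⬝ᵥ (M *ᵥ x) = lambdaMin M * (x ⬝ᵥ x)) : M *ᵥ x = lambdaMin M • x := by
  have h := (posSemidef_sub_lambdaMin hM).dotProduct_mulVec_zero_iff x
  rw [sub_algebraMap_mulVec, star_trivial, dotProduct_sub, dotProduct_smul, smul_eq_mul, hx,
    sub_self, sub_eq_zero] at h
  exact h.1 rfl

lemma exists_mulVec_eq_lambdaMin_smul [Nonempty n] (hM : M.IsHermitian) :
    ∃ v ≠ 0, M *ᵥ v = lambdaMin M • v := by
  have hne : (spectrum ℝ M).Nonempty :=
    ⟨_, hM.eigenvalues_mem_spectrum_real (Classical.arbitrary n)⟩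
  have hmem : lambdaMin M ∈ spectrum ℝ M := hne.csInf_mem M.finite_real_spectrum
  rw [← Matrix.spectrum_toLin', ← Module.End.hasEigenvalue_iff_mem_spectrum] at hmem
  obtain ⟨v, hv⟩ := hmem.exists_hasEigenvector
  exact ⟨v, hv.2, by simpa using hv.apply_eq_smul⟩

end


/-- Deleting the last row and column of an irreducible symmetric matrix with nonpositive
off-diagonal entries strictly increases the smallest eigenvalue. -/
lemma MatIrreducible.lambdaMin_lt_submatrix_castSucc {n : ℕ} [NeZero n]
    {M : Matrix (Fin (n + 1)) (Fin (n + 1)) ℝ} (hirr : MatIrreducible M) (hM : M.IsSymm)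
    (hoff : ∀ i j, i ≠ j → M i j ≤ 0) :
    lambdaMin M < lambdaMin (M.submatrix Fin.castSucc Fin.castSucc) := by
  set B := M.submatrix Fin.castSucc Fin.castSucc with hB
  have hMH : M.IsHermitian := hM
  obtain ⟨v, hv0, hv⟩ := exists_mulVec_eq_lambdaMin_smul (hMH.submatrix Fin.castSucc)
  rw [← hB] at hv
  let x : Fin (n + 1) → ℝ := Fin.snoc (fun i => |v i|) 0
  have hxs : ∀ i : Fin n, x i.castSucc = |v i| := fun i => by simp [x]
  have hxl : x (Fin.last n) = 0 := by simp [x]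
  have hx0 : x ≠ 0 := fun h => hv0 <| funext fun i => by
    simpa [hxs] using congrFun h i.castSucc
  have hxx : x ⬝ᵥ x = v ⬝ᵥ v := by
    simp [dotProduct, Fin.sum_univ_castSucc, hxs, hxl]
  have hxM : x ⬝ᵥ (M *ᵥ x) = (fun i => |v i|) ⬝ᵥ (B *ᵥ fun i => |v i|) := by
    simp [dotProduct, mulVec, Fin.sum_univ_castSucc, hxs, hxl, hB]
  have hxle : x ⬝ᵥ (M *ᵥ x) ≤ lambdaMin B * (x ⬝ᵥ x) := by
    rw [hxM, hxx, ← smul_eq_mul, ← dotProduct_smul, ← hv]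
    exact abs_dotProduct_mulVec_abs_le
      (fun i j hij => hoff _ _ fun h => hij (Fin.castSucc_injective n h)) v
  have hpos : 0 < x ⬝ᵥ x :=
    lt_of_le_of_ne (Finset.sum_nonneg fun i _ => mul_self_nonneg (x i))
      fun h => hx0 (dotProduct_self_eq_zero.1 h.symm)
  have hge := lambdaMin_mul_le hMH x
  by_contra! hlt
  have heq : x ⬝ᵥ (M *ᵥ x) = lambdaMin M * (x ⬝ᵥ x) :=
    le_antisymm (hxle.trans (mul_le_mul_of_nonneg_right hlt hpos.le)) hge
  have hxnn : 0 ≤ x := fun i => by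
    induction i using Fin.lastCases with
    | last => exact hxl.ge
    | cast i => exact (hxs i).symm ▸ abs_nonneg _
  exact hx0 (hirr.eq_zero_of_mulVec_eq_smul hM hoff hxnn (mulVec_eq_lambdaMin_smul hMH heq) hxl)

/-- Placing a grid-forming converter at the last node strictly increases the smallest
eigenvalue of the weighted Kron-reduced Laplacian (paper's Lemma 1). -/
theorem stmt0 (n : ℕ) (hn : 1 ≤ n)
    (Q : Matrix (Fin (n + 1)) (Fin (n + 1)) ℝ)
    (hQsymm : Q.IsSymm) (hQpd : Q.PosDef)
    (hQoff : ∀ i j, i ≠ j → Q i j ≤ 0)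
    (hQirr : MatIrreducible Q)
    (s : Fin (n + 1) → ℝ) (hs : ∀ i, 0 < s i) :
    lambdaMin ((Matrix.diagonal fun i => (Real.sqrt (s i))⁻¹) * Q *
        (Matrix.diagonal fun i => (Real.sqrt (s i))⁻¹)) <
      lambdaMin ((Matrix.diagonal fun i : Fin n => (Real.sqrt (s i.castSucc))⁻¹) *
        (Q.submatrix Fin.castSucc Fin.castSucc) *
        (Matrix.diagonal fun i : Fin n => (Real.sqrt (s i.castSucc))⁻¹)) := by
  have : NeZero n := ⟨by lia⟩
  have hd : ∀ i, 0 < (Real.sqrt (s i))⁻¹ := fun i => inv_pos.2 (Real.sqrt_pos.2 (hs i))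
  set M := (Matrix.diagonal fun i => (Real.sqrt (s i))⁻¹) * Q *
    (Matrix.diagonal fun i => (Real.sqrt (s i))⁻¹) with hM
  have hMij : ∀ i j, M i j = (Real.sqrt (s i))⁻¹ * Q i j * (Real.sqrt (s j))⁻¹ := fun i j => by
    rw [hM, Matrix.mul_diagonal, Matrix.diagonal_mul]
  have hsub : (Matrix.diagonal fun i : Fin n => (Real.sqrt (s i.castSucc))⁻¹) *
      (Q.submatrix Fin.castSucc Fin.castSucc) *
      (Matrix.diagonal fun i : Fin n => (Real.sqrt (s i.castSucc))⁻¹) =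
      M.submatrix Fin.castSucc Fin.castSucc := by
    ext i j
    rw [Matrix.mul_diagonal, Matrix.diagonal_mul, Matrix.submatrix_apply, Matrix.submatrix_apply,
      hMij]
  rw [hsub]
  refine MatIrreducible.lambdaMin_lt_submatrix_castSucc (fun A hA hA' => ?_)
    (Matrix.IsSymm.ext fun i j => ?_) fun i j hij => ?_
  · obtain ⟨i, hi, j, hj, hij⟩ := hQirr A hA hA'
    exact ⟨i, hi, j, hj, hMij i j ▸ mul_ne_zero (mul_ne_zero (hd i).ne' hij) (hd j).ne'⟩
  · rw [hMij, hMij, hQsymm.apply]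
    ring
  · rw [hMij]
    exact mul_nonpos_of_nonpos_of_nonneg
      (mul_nonpos_of_nonneg_of_nonpos (hd i).le (hQoff i j hij)) (hd j).le
end

section
/- Let n ≥ 1. Let S_B, Q_n ∈ ℂ^{n×n}, let c ∈ ℂ^{n×1} be a column matrix and r ∈ ℂ^{1×n} a row matrix, let q ∈ ℂ, and let Y, G, F ∈ ℂ^{2×2}. Assume F is invertible and C := G + q·F is invertible. Consider the (2n+2)×(2n+2) block matrix M with top-left block S_B ⊗ Y + Q_n ⊗ F, top-right block c ⊗ F, bottom-left block r ⊗ F, and bottom-right block C. Then det M = det(C) · det(F)^n · det( S_B ⊗ (Y F^{-1}) + Q_n ⊗ I_2 − (c·r) ⊗ (F C^{-1}) ), where ⊗ denotes the Kronecker product and c·r ∈ ℂ^{n×n} is the rank-one product of the column c and row r. -/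
open Matrix
open scoped Kronecker

theorem kronecker_col_mul_mul_kronecker_row {l m p R : Type*} [Fintype p] [CommSemiring R]
    (c : Matrix l (Fin 1) R) (r : Matrix (Fin 1) m R) (A D B : Matrix p p R) :
    (c ⊗ₖ A).submatrix id (fun j : p => ((0 : Fin 1), j)) * D *
        (r ⊗ₖ B).submatrix (fun i : p => ((0 : Fin 1), i)) id =
      (c * r) ⊗ₖ (A * D * B) := by
  ext ⟨i, a⟩ ⟨j, b⟩
  simp only [Matrix.mul_apply, submatrix_apply, kroneckerMap_apply, id_eq, Finset.univ_unique,
    Fin.default_eq_zero, Finset.sum_singleton, Finset.mul_sum, Finset.sum_mul]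
  refine Finset.sum_congr rfl fun x _ => Finset.sum_congr rfl fun y _ => ?_
  ring

/-- Determinant identity (eqs. 20–21) for the closed-loop system with `n` PLL-based
converters and one grid-forming converter: the block determinant factorizes into the
grid-forming subsystem determinant `det(G + q F)`, `det(F)^n`, and a reduced determinant
containing the rank-one perturbation `(c·r) ⊗ (F C⁻¹)`. -/
theorem stmt8 (n : ℕ) (hn : 1 ≤ n)
    (SB Qn : Matrix (Fin n) (Fin n) ℂ)
    (c : Matrix (Fin n) (Fin 1) ℂ) (r : Matrix (Fin 1) (Fin n) ℂ)
    (q : ℂ) (Y G F : Matrix (Fin 2) (Fin 2) ℂ)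
    (hF : IsUnit F.det) (hC : IsUnit (G + q • F).det) :
    (Matrix.fromBlocks (SB ⊗ₖ Y + Qn ⊗ₖ F)
        ((c ⊗ₖ F).submatrix id fun j : Fin 2 => ((0 : Fin 1), j))
        ((r ⊗ₖ F).submatrix (fun i : Fin 2 => ((0 : Fin 1), i)) id)
        (G + q • F)).det =
      (G + q • F).det * F.det ^ n *
        (SB ⊗ₖ (Y * F⁻¹) + Qn ⊗ₖ (1 : Matrix (Fin 2) (Fin 2) ℂ) -
          (c * r) ⊗ₖ (F * (G + q • F)⁻¹)).det := by
  let _ := (G + q • F).invertibleOfIsUnitDet hC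
  have factor : SB ⊗ₖ Y + Qn ⊗ₖ F - (c * r) ⊗ₖ (F * (G + q • F)⁻¹ * F) =
      (SB ⊗ₖ (Y * F⁻¹) + Qn ⊗ₖ (1 : Matrix (Fin 2) (Fin 2) ℂ) -
        (c * r) ⊗ₖ (F * (G + q • F)⁻¹)) * ((1 : Matrix (Fin n) (Fin n) ℂ) ⊗ₖ F) := by
    simp only [Matrix.sub_mul, Matrix.add_mul, ← mul_kronecker_mul, Matrix.mul_one,
      Matrix.one_mul, nonsing_inv_mul_cancel_right _ _ hF]
  rw [det_fromBlocks₂₂, kronecker_col_mul_mul_kronecker_row, invOf_eq_nonsing_inv, factor,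
    det_mul, det_kronecker, det_one, one_pow, one_mul, Fintype.card_fin]
  ring
end
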